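/- Let G be a d-regular graph with n vertices, and consider the external DLA process on the cylinder graph G × N started from the zeroth level. Let D(m) = (1/(mn)) Σ_{i=1}^m |E_∞ ∩ G_i| be the empirical density of the cluster at infinity E_∞ in the first m levels, and let D = lim_{m→∞} D(m) be the density at infinity (which exists and is a.s. constant). Then D = lim_{m→∞} (1/(mn)) E[T_m], where T_m is the first time the DLA cluster reaches level m. -/

import Mathlib

open MeasureTheory Filter Topology

open Classical in
/-- Probability that the random walk which at each step moves uniformly to one of the
points in `nbr ·`, started at `x`, hits the set `A` within `n` steps, with first
hitting position `y`. -/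
noncomputable def hitP {V : Type*} (nbr : V → Finset V) (A : Set V) : ℕ → V → V → ℝ
  | 0, x, y => if x ∈ A ∧ x = y then 1 else 0
  | n+1, x, y =>
      if x ∈ A then (if x = y then 1 else 0)
      else ((nbr x).card : ℝ)⁻¹ * ∑ z ∈ nbr x, hitP nbr A n z y

/-- The hitting distribution `H_A(x,y)`. -/
noncomputable def hitMeas {V : Type*} (nbr : V → Finset V) (A : Set V) (x y : V) : ℝ :=
  ⨆ n, hitP nbr A n x y

/-- Outer boundary of a finite set. -/
noncomputable def bdryF {V : Type*} [DecidableEq V] (nbr : V → Finset V) (A : Finset V) :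
    Finset V :=
  A.biUnion nbr \ A

open Classical in
/-- `n`-step transition probabilities of the random walk which at each step moves
uniformly to one of the points in `nbr ·`. -/
noncomputable def pstep {V : Type*} (nbr : V → Finset V) : ℕ → V → V → ℝ
  | 0, x, y => if x = y then 1 else 0
  | n+1, x, y => ((nbr x).card : ℝ)⁻¹ * ∑ z ∈ nbr x, pstep nbr n z y

/-- Total-variation mixing time (with the usual threshold `1/4`) of the simple random
walk on a finite (regular) graph given by the neighbor function `nbr`, whose stationary
distribution is uniform. -/
noncomputable def tmix {V : Type*} [Fintype V] (nbr : V → Finset V) : ℕ :=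
  sInf {t : ℕ | ∀ u : V,
    (∑ v : V, |pstep nbr t u v - (Fintype.card V : ℝ)⁻¹|) / 2 ≤ 1/4}

/-- The neighbor function of the cylinder graph `G × ℕ`. -/
noncomputable def cylNbr {V : Type*} [DecidableEq V] [Fintype V] (G : SimpleGraph V)
    [DecidableRel G.Adj] (v : V × ℕ) : Finset (V × ℕ) :=
  (G.neighborFinset v.1).image (fun u => (u, v.2)) ∪
    (if v.2 = 0 then {(v.1, 1)} else {(v.1, v.2 + 1), (v.1, v.2 - 1)})

/-- The first time the cluster `E` reaches level `m` of the cylinder. -/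
noncomputable def levelTime {V : Type*} {Ω : Type*} (E : ℕ → Ω → Finset (V × ℕ))
    (m : ℕ) (ω : Ω) : ℕ :=
  sInf {t : ℕ | ∃ v : V, (v, m) ∈ E t ω}

section HittingDistribution

variable {V : Type*} (nbr : V → Finset V) (A : Set V)

lemma hitP_nonneg (N : ℕ) (x y : V) : 0 ≤ hitP nbr A N x y := by
  induction N generalizing x with
  | zero => simp only [hitP]; split_ifs <;> norm_num
  | succ N ih =>
    simp only [hitP]
    split_ifs
    · norm_num
    · norm_num
    · exact mul_nonneg (by positivity) (Finset.sum_nonneg fun z _ => ih z)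

lemma inv_card_mul_sum_le (s : Finset V) (f : V → ℝ) {c : ℝ} (hc : 0 ≤ c)
    (h : ∀ z ∈ s, f z ≤ c) : (s.card : ℝ)⁻¹ * ∑ z ∈ s, f z ≤ c := by
  rcases s.eq_empty_or_nonempty with rfl | hs
  · simpa using hc
  · have hpos : (0 : ℝ) < s.card := by exact_mod_cast hs.card_pos
    rw [inv_mul_le_iff₀ hpos]
    simpa [nsmul_eq_mul] using Finset.sum_le_card_nsmul s f c h

/-- An average over `s` of a function bounded by `c` that is at most `c * (1 - e)` at one point. -/
lemma inv_card_mul_sum_le_of_mem (s : Finset V) (f : V → ℝ) {c e δ : ℝ} (hc : 0 ≤ c) (he : 0 ≤ e)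
    (h : ∀ z ∈ s, f z ≤ c) {a : V} (ha : a ∈ s) (hfa : f a ≤ c * (1 - e))
    (hδ : δ ≤ (s.card : ℝ)⁻¹) : (s.card : ℝ)⁻¹ * ∑ z ∈ s, f z ≤ c * (1 - δ * e) := by
  classical
  have hpos : (0 : ℝ) < s.card := by exact_mod_cast Finset.card_pos.2 ⟨a, ha⟩
  have h1 : ∑ z ∈ s.erase a, f z ≤ (s.card - 1) * c := by
    have := Finset.sum_le_card_nsmul (s.erase a) f c fun z hz => h z (Finset.mem_of_mem_erase hz)
    rwa [nsmul_eq_mul, Finset.cast_card_erase_of_mem ha] at this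
  rw [← Finset.add_sum_erase s f ha]
  calc (s.card : ℝ)⁻¹ * (f a + ∑ z ∈ s.erase a, f z)
      ≤ (s.card : ℝ)⁻¹ * (c * (1 - e) + (s.card - 1) * c) := by gcongr
    _ = c * (1 - (s.card : ℝ)⁻¹ * e) := by field_simp; ring
    _ ≤ c * (1 - δ * e) := by gcongr

lemma sum_hitP_zero_of_notMem {F : Finset V} {x : V} (hx : x ∉ F) :
    ∑ y ∈ F, hitP nbr A 0 x y = 0 :=
  Finset.sum_eq_zero fun y hy => by
    have : x ≠ y := fun h => hx (h ▸ hy)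
    simp [hitP, this]

lemma sum_hitP_succ_of_mem_of_notMem {F : Finset V} {N : ℕ} {x : V} (hxA : x ∈ A) (hx : x ∉ F) :
    ∑ y ∈ F, hitP nbr A (N + 1) x y = 0 :=
  Finset.sum_eq_zero fun y hy => by
    have : x ≠ y := fun h => hx (h ▸ hy)
    simp [hitP, this, hxA]

lemma sum_hitP_succ_of_notMem (F : Finset V) (N : ℕ) {x : V} (hxA : x ∉ A) :
    ∑ y ∈ F, hitP nbr A (N + 1) x y =
      ((nbr x).card : ℝ)⁻¹ * ∑ z ∈ nbr x, ∑ y ∈ F, hitP nbr A N z y := by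
  simp only [hitP, if_neg hxA]
  rw [← Finset.mul_sum, Finset.sum_comm]

lemma sum_hitP_le_one (F : Finset V) (N : ℕ) (x : V) : ∑ y ∈ F, hitP nbr A N x y ≤ 1 := by
  classical
  have key : ∑ y ∈ F, (if x = y then (1 : ℝ) else 0) ≤ 1 := by
    rw [Finset.sum_ite_eq]; split_ifs <;> norm_num
  induction N generalizing x with
  | zero =>
    refine le_trans (Finset.sum_le_sum fun y _ => ?_) key
    simp only [hitP]
    split_ifs <;> simp_all
  | succ N ih =>
    by_cases hx : x ∈ A
    · simpa only [hitP, if_pos hx] using key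
    · rw [sum_hitP_succ_of_notMem nbr A F N hx]
      exact inv_card_mul_sum_le _ _ zero_le_one fun z _ => ih z (by
        rw [Finset.sum_ite_eq]; split_ifs <;> norm_num)

lemma hitP_mono (x y : V) : Monotone fun N => hitP nbr A N x y := by
  refine monotone_nat_of_le_succ fun N => ?_
  induction N generalizing x with
  | zero =>
    by_cases hx : x ∈ A
    · simp only [hitP, if_pos hx]
      split_ifs <;> simp_all
    · have : hitP nbr A 0 x y = 0 := by simp [hitP, hx]
      rw [this]
      exact hitP_nonneg ..
  | succ N ih =>
    rw [hitP, hitP]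
    split_ifs
    · rfl
    · rfl
    · exact mul_le_mul_of_nonneg_left (Finset.sum_le_sum fun z _ => ih z) (by positivity)

lemma tendsto_hitP (x y : V) :
    Tendsto (fun N => hitP nbr A N x y) atTop (𝓝 (hitMeas nbr A x y)) :=
  tendsto_atTop_ciSup (hitP_mono nbr A x y)
    ⟨1, by rintro _ ⟨N, rfl⟩; simpa using sum_hitP_le_one nbr A {y} N x⟩

lemma hitMeas_nonneg (x y : V) : 0 ≤ hitMeas nbr A x y :=
  Real.iSup_nonneg fun N => hitP_nonneg nbr A N x y

lemma sum_hitMeas_le {F : Finset V} {x : V} {c : ℝ}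
    (h : ∀ N, ∑ y ∈ F, hitP nbr A N x y ≤ c) : ∑ y ∈ F, hitMeas nbr A x y ≤ c :=
  le_of_tendsto' (tendsto_finsetSum _ fun y _ => tendsto_hitP nbr A x y) h

end HittingDistribution

section Cylinder

variable {V : Type*} [DecidableEq V] [Fintype V] (G : SimpleGraph V) [DecidableRel G.Adj]

lemma mem_cylNbr_iff {p q : V × ℕ} : q ∈ cylNbr G p ↔
    (G.Adj p.1 q.1 ∧ p.2 = q.2) ∨ (p.1 = q.1 ∧ (p.2 = q.2 + 1 ∨ q.2 = p.2 + 1)) := by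
  obtain ⟨v, k⟩ := p
  obtain ⟨u, l⟩ := q
  by_cases hk : k = 0
  · subst hk
    simp [cylNbr, eq_comm]
    grind
  · simp [cylNbr, hk, eq_comm]
    grind

lemma mem_cylNbr_comm {p q : V × ℕ} : q ∈ cylNbr G p ↔ p ∈ cylNbr G q := by
  rw [mem_cylNbr_iff, mem_cylNbr_iff, G.adj_comm]
  grind

lemma snd_le_of_mem_cylNbr {p q : V × ℕ} (h : q ∈ cylNbr G p) : q.2 ≤ p.2 + 1 := by
  rw [mem_cylNbr_iff] at h
  omega

lemma card_cylNbr_le (p : V × ℕ) : (cylNbr G p).card ≤ Fintype.card V + 2 := by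
  refine (Finset.card_union_le _ _).trans (add_le_add ?_ ?_)
  · exact Finset.card_image_le.trans (Finset.card_le_univ _)
  · split_ifs
    · simp
    · exact Finset.card_le_two

lemma mem_bdryF_iff {A : Finset (V × ℕ)} {p : V × ℕ} :
    p ∈ bdryF (cylNbr G) A ↔ (∃ a ∈ A, p ∈ cylNbr G a) ∧ p ∉ A := by
  simp [bdryF]

/-- A walk on the cylinder started above level `m + k`, outside of a set `A` that meets every level
up to `m + k`, has probability at most `(1 - (n + 2)⁻ⁿ) ^ k` to hit the outer boundary of `A`
for the first time in a point at a level at most `m`. -/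
lemma sum_hitP_bdryF_le (hG : G.Connected) {A F : Finset (V × ℕ)} {m K : ℕ}
    (hF : ∀ y ∈ F, y.2 ≤ m) (hA : ∀ j ≤ m + K, ∃ v, (v, j) ∈ A) {k : ℕ} (hk : k ≤ K)
    (N : ℕ) {x : V × ℕ} (hxA : x ∉ A) (hx : m + k ≤ x.2) :
    ∑ y ∈ F, hitP (cylNbr G) (bdryF (cylNbr G) A) N x y ≤
      (1 - (((Fintype.card V : ℝ) + 2)⁻¹) ^ Fintype.card V) ^ k := by
  set δ : ℝ := ((Fintype.card V : ℝ) + 2)⁻¹ with hδ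
  have hδ0 : 0 ≤ δ := by positivity
  have hδ1 : δ ≤ 1 := inv_le_one_of_one_le₀ (by linarith [(Fintype.card V).cast_nonneg (α := ℝ)])
  have hq0 : 0 ≤ 1 - δ ^ Fintype.card V := sub_nonneg.2 (pow_le_one₀ hδ0 hδ1)
  have hδc : ∀ p, (cylNbr G p).Nonempty → δ ≤ ((cylNbr G p).card : ℝ)⁻¹ := fun p hp =>
    inv_anti₀ (by exact_mod_cast hp.card_pos) (by exact_mod_cast card_cylNbr_le G p)
  have hout : ∀ p, p ∉ A → p ∉ (bdryF (cylNbr G) A : Set (V × ℕ)) →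
      ∀ z ∈ cylNbr G p, z ∉ A := fun p hpA hpB z hz hzA =>
    hpB (Finset.mem_coe.2 ((mem_bdryF_iff G).2 ⟨⟨z, hzA, (mem_cylNbr_comm G).1 hz⟩, hpA⟩))
  have hnF : ∀ p : V × ℕ, m < p.2 → p ∉ F := fun p hp hpF => (hF p hpF).not_gt hp
  induction k generalizing N x with
  | zero => simpa using sum_hitP_le_one _ _ F N x
  | succ k ih =>
    have ih' := fun N (x : V × ℕ) => @ih (by omega) N x
    set M := (1 - δ ^ Fintype.card V) ^ k with hM
    have hM0 : 0 ≤ M := pow_nonneg hq0 k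
    have hwalk : ∀ (u w : V) (p : G.Walk u w) (N : ℕ), (w, m + (k + 1)) ∈ A →
        (u, m + (k + 1)) ∉ A →
        ∑ y ∈ F, hitP (cylNbr G) (bdryF (cylNbr G) A) N (u, m + (k + 1)) y ≤
          M * (1 - δ ^ p.length) := by
      intro u w p
      induction p with
      | nil => intro N h1 h2; exact absurd h1 h2
      | @cons u u' w hadj p ihp =>
        intro N h1 h2
        have hnn : 0 ≤ M * (1 - δ ^ (SimpleGraph.Walk.cons hadj p).length) :=
          mul_nonneg hM0 (sub_nonneg.2 (pow_le_one₀ hδ0 hδ1))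
        have hnu : (u, m + (k + 1)) ∉ F := hnF _ (by simp)
        cases N with
        | zero => rwa [sum_hitP_zero_of_notMem _ _ hnu]
        | succ N =>
          by_cases hB : (u, m + (k + 1)) ∈ (bdryF (cylNbr G) A : Set (V × ℕ))
          · rwa [sum_hitP_succ_of_mem_of_notMem _ _ hB hnu]
          · rw [sum_hitP_succ_of_notMem _ _ _ _ hB, SimpleGraph.Walk.length_cons, pow_succ']
            have hmem : (u', m + (k + 1)) ∈ cylNbr G (u, m + (k + 1)) := by
              rw [mem_cylNbr_iff]; exact Or.inl ⟨hadj, rfl⟩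
            refine inv_card_mul_sum_le_of_mem _ _ hM0 (by positivity) (fun z hz => ?_) hmem
              (ihp N h1 (hout _ h2 hB _ hmem)) (hδc _ ⟨_, hmem⟩)
            refine ih' N z (hout _ h2 hB z hz) ?_
            have := snd_le_of_mem_cylNbr G ((mem_cylNbr_comm G).1 hz)
            simp only at this
            omega
    have hlev : ∀ (N : ℕ) (u : V), (u, m + (k + 1)) ∉ A →
        ∑ y ∈ F, hitP (cylNbr G) (bdryF (cylNbr G) A) N (u, m + (k + 1)) y ≤
          M * (1 - δ ^ Fintype.card V) := by
      intro N u hu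
      obtain ⟨w, hw⟩ := hA (m + (k + 1)) (by omega)
      obtain ⟨p, hp⟩ := hG.exists_isPath u w
      refine (hwalk u w p N hw hu).trans ?_
      have := pow_le_pow_of_le_one hδ0 hδ1 hp.length_lt.le
      gcongr
    rw [pow_succ]
    induction N generalizing x with
    | zero =>
      rw [sum_hitP_zero_of_notMem _ _ (hnF x (by omega))]
      positivity
    | succ N ihN =>
      rcases hx.eq_or_lt with h | h
      · obtain ⟨u, l⟩ := x
        simp only at h
        subst h
        exact hlev (N + 1) u hxA
      · by_cases hB : x ∈ (bdryF (cylNbr G) A : Set (V × ℕ))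
        · rw [sum_hitP_succ_of_mem_of_notMem _ _ hB (hnF x (by omega))]
          positivity
        · rw [sum_hitP_succ_of_notMem _ _ _ _ hB]
          refine inv_card_mul_sum_le _ _ (by positivity) fun z hz => ?_
          refine ihN (hout _ hxA hB z hz) ?_
          have := snd_le_of_mem_cylNbr G ((mem_cylNbr_comm G).1 hz)
          omega

end Cylinder

section Visited

variable {V : Type*} [Fintype V] {Ω : Type*} {E : ℕ → Ω → Finset (V × ℕ)}

open Classical in
/-- The vertices at the levels `1, …, m` that are eventually in the cluster. -/
noncomputable def visited (E : ℕ → Ω → Finset (V × ℕ)) (m : ℕ) (ω : Ω) : Finset (V × ℕ) :=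
  (Finset.univ ×ˢ Finset.Icc 1 m).filter fun p => ∃ t, p ∈ E t ω

lemma mem_visited {m : ℕ} {ω : Ω} {p : V × ℕ} :
    p ∈ visited E m ω ↔ (1 ≤ p.2 ∧ p.2 ≤ m) ∧ ∃ t, p ∈ E t ω := by
  simp [visited]

lemma sum_ncard_eq_card_visited (E : ℕ → Ω → Finset (V × ℕ)) (m : ℕ) (ω : Ω) :
    ∑ i ∈ Finset.Icc 1 m, ({p ∈ ⋃ t, (E t ω : Set (V × ℕ)) | p.2 = i}).ncard =
      (visited E m ω).card := by
  rw [Finset.card_eq_sum_card_fiberwise (f := Prod.snd) (t := Finset.Icc 1 m)]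
  · refine Finset.sum_congr rfl fun i hi => ?_
    rw [← Set.ncard_coe_finset]
    congr 1
    ext p
    have := Finset.mem_Icc.1 hi
    simp only [Set.mem_iUnion, Finset.mem_coe, Set.mem_ofPred_eq, Finset.mem_filter, mem_visited]
    constructor
    · rintro ⟨h, rfl⟩
      exact ⟨⟨this, h⟩, rfl⟩
    · rintro ⟨⟨_, h⟩, h'⟩
      exact ⟨h, h'⟩
  · intro p hp
    exact Finset.mem_coe.2 (Finset.mem_Icc.2 (mem_visited.1 (Finset.mem_coe.1 hp)).1)

lemma card_visited_le (E : ℕ → Ω → Finset (V × ℕ)) (m : ℕ) (ω : Ω) :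
    (visited E m ω).card ≤ Fintype.card V * m := by
  classical
  refine (Finset.card_filter_le _ _).trans ?_
  simp

lemma card_visited_add_le (E : ℕ → Ω → Finset (V × ℕ)) (m k : ℕ) (ω : Ω) :
    (visited E (m + k) ω).card ≤ (visited E m ω).card + Fintype.card V * k := by
  classical
  have hsub : visited E (m + k) ω ⊆
      visited E m ω ∪ Finset.univ ×ˢ Finset.Ioc m (m + k) := by
    intro p hp
    rw [mem_visited] at hp
    rw [Finset.mem_union, mem_visited]
    by_cases h : p.2 ≤ m
    · exact Or.inl ⟨⟨hp.1.1, h⟩, hp.2⟩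
    · exact Or.inr (by simp; omega)
  refine (Finset.card_le_card hsub).trans ((Finset.card_union_le _ _).trans ?_)
  simp

end Visited

section Growth

variable {V : Type*} [DecidableEq V] [Fintype V] {G : SimpleGraph V} [DecidableRel G.Adj]
  {Ω : Type*} {E : ℕ → Ω → Finset (V × ℕ)} {Y : ℕ → Ω → V × ℕ}

/-- The clusters `E` start from the zeroth level of the cylinder and grow by adding at each step
the vertex given by `Y`, which lies in the outer boundary of the current cluster. -/
structure IsClusterGrowth (G : SimpleGraph V) [DecidableRel G.Adj]
    (E : ℕ → Ω → Finset (V × ℕ)) (Y : ℕ → Ω → V × ℕ) : Prop where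
  zero : ∀ ω, E 0 ω = Finset.univ.image (fun v : V => (v, 0))
  step : ∀ t ω, E (t + 1) ω = insert (Y (t + 1) ω) (E t ω)
  mem_bdryF : ∀ t ω, Y (t + 1) ω ∈ bdryF (cylNbr G) (E t ω)

namespace IsClusterGrowth

variable (h : IsClusterGrowth G E Y)
include h

lemma monotone (ω : Ω) : Monotone fun t => E t ω :=
  monotone_nat_of_le_succ fun t => by
    rw [h.step]
    exact Finset.subset_insert _ _

lemma notMem (t : ℕ) (ω : Ω) : Y (t + 1) ω ∉ E t ω :=
  ((mem_bdryF_iff G).1 (h.mem_bdryF t ω)).2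

lemma mem (t : ℕ) (ω : Ω) : Y (t + 1) ω ∈ E (t + 1) ω := by
  rw [h.step]
  exact Finset.mem_insert_self _ _

lemma zero_mem (t : ℕ) (ω : Ω) (v : V) : (v, 0) ∈ E t ω :=
  h.monotone ω (Nat.zero_le t) (by simp [h.zero])

lemma one_le_snd (t : ℕ) (ω : Ω) : 1 ≤ (Y (t + 1) ω).2 := by
  by_contra! hlt
  refine h.notMem t ω ?_
  have := h.zero_mem t ω (Y (t + 1) ω).1
  rwa [← Nat.lt_one_iff.1 hlt] at this

lemma injective (ω : Ω) : Function.Injective fun t => Y (t + 1) ω := by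
  intro s t (hst : Y (s + 1) ω = Y (t + 1) ω)
  by_contra hne
  rcases Nat.lt_or_gt_of_ne hne with hlt | hlt
  · exact h.notMem t ω (hst ▸ h.monotone ω hlt (h.mem s ω))
  · exact h.notMem s ω (hst ▸ h.monotone ω hlt (h.mem t ω))

lemma exists_mem_of_le {t : ℕ} {ω : Ω} {p : V × ℕ} (hp : p ∈ E t ω) {j : ℕ} (hj : j ≤ p.2) :
    ∃ v, (v, j) ∈ E t ω := by
  induction t generalizing p j with
  | zero =>
    rw [h.zero] at hp
    obtain ⟨v, -, rfl⟩ := Finset.mem_image.1 hp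
    obtain rfl : j = 0 := by simpa using hj
    exact ⟨v, h.zero_mem 0 ω v⟩
  | succ t ih =>
    have hmono := h.monotone ω t.le_succ
    rw [h.step, Finset.mem_insert] at hp
    rcases hp with rfl | hp
    · obtain ⟨a, ha, hY⟩ := ((mem_bdryF_iff G).1 (h.mem_bdryF t ω)).1
      have := snd_le_of_mem_cylNbr G hY
      rcases Nat.lt_or_ge a.2 j with hlt | hle
      · obtain rfl : j = (Y (t + 1) ω).2 := by omega
        exact ⟨_, h.mem t ω⟩
      · obtain ⟨v, hv⟩ := ih ha hle
        exact ⟨v, hmono hv⟩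
    · obtain ⟨v, hv⟩ := ih hp hj
      exact ⟨v, hmono hv⟩

lemma card_eq (t : ℕ) (ω : Ω) : (E t ω).card = Fintype.card V + t := by
  induction t with
  | zero =>
    rw [h.zero, Finset.card_image_of_injective _ fun a b hab => (Prod.ext_iff.1 hab).1]
    rfl
  | succ t ih => rw [h.step, Finset.card_insert_of_notMem (h.notMem t ω), ih, add_assoc]

lemma exists_mem_level [Nonempty V] {m t : ℕ} (ht : Fintype.card V * m ≤ t) (ω : Ω) :
    ∃ v, (v, m) ∈ E t ω := by
  by_contra hno
  have hsub : E t ω ⊆ Finset.univ ×ˢ Finset.range m := by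
    intro p hp
    by_contra hp'
    exact hno (h.exists_mem_of_le hp (by simpa using hp'))
  have := Finset.card_le_card hsub
  rw [h.card_eq, Finset.card_product, Finset.card_univ, Finset.card_range] at this
  have := Fintype.card_pos (α := V)
  omega

lemma exists_eq_of_mem {t : ℕ} {ω : Ω} {p : V × ℕ} (hp : p ∈ E t ω) (hp1 : 1 ≤ p.2) :
    ∃ s, Y (s + 1) ω = p := by
  induction t with
  | zero =>
    rw [h.zero] at hp
    obtain ⟨v, -, rfl⟩ := Finset.mem_image.1 hp
    simp at hp1
  | succ t ih =>
    rw [h.step, Finset.mem_insert] at hp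
    rcases hp with rfl | hp
    · exact ⟨t, rfl⟩
    · exact ih hp

lemma lt_levelTime_iff [Nonempty V] {m t : ℕ} {ω : Ω} :
    t < levelTime E m ω ↔ ¬ ∃ v, (v, m) ∈ E t ω := by
  constructor
  · intro hlt
    exact Nat.notMem_of_lt_sInf hlt
  · intro hno
    by_contra! hle
    obtain ⟨v, hv⟩ : ∃ v, (v, m) ∈ E (levelTime E m ω) ω :=
      Nat.sInf_mem (s := {t | ∃ v, (v, m) ∈ E t ω}) ⟨_, h.exists_mem_level le_rfl ω⟩
    exact hno ⟨v, h.monotone ω hle hv⟩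

lemma levelTime_le_card_visited [Nonempty V] (m : ℕ) (ω : Ω) :
    levelTime E m ω ≤ (visited E m ω).card := by
  have := Finset.card_le_card_of_injOn (s := Finset.range (levelTime E m ω))
    (t := visited E m ω) (fun s => Y (s + 1) ω) ?_ (h.injective ω).injOn
  · simpa using this
  · intro s hs
    have hs' := h.lt_levelTime_iff.1 (Finset.mem_range.1 (Finset.mem_coe.1 hs))
    refine mem_visited.2 ⟨⟨h.one_le_snd s ω, ?_⟩, s + 1, h.mem s ω⟩
    obtain ⟨a, ha, hY⟩ := ((mem_bdryF_iff G).1 (h.mem_bdryF s ω)).1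
    by_contra! hlt
    exact hs' (h.exists_mem_of_le ha (by have := snd_le_of_mem_cylNbr G hY; omega))

open scoped ENNReal in
lemma tsum_lt_levelTime [Nonempty V] (m : ℕ) (ω : Ω) :
    ∑' t, {ω | ¬ ∃ v, (v, m) ∈ E t ω}.indicator (1 : Ω → ℝ≥0∞) ω = levelTime E m ω := by
  rw [tsum_eq_sum (s := Finset.range (levelTime E m ω))]
  · rw [Finset.sum_congr rfl (g := fun _ => 1)]
    · simp
    · intro t ht
      have := h.lt_levelTime_iff.1 (Finset.mem_range.1 ht)
      exact Set.indicator_of_mem (s := {ω | ¬ ∃ v, (v, m) ∈ E t ω}) this _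
  · intro t ht
    have := mt h.lt_levelTime_iff.2 (mt Finset.mem_range.2 ht)
    exact Set.indicator_of_notMem (s := {ω | ¬ ∃ v, (v, m) ∈ E t ω}) this _

open scoped ENNReal in
/-- Every vertex at a level at most `m` is added either before level `l` is reached, or after. -/
lemma card_visited_le_levelTime_add [Nonempty V] (m l : ℕ) (ω : Ω) :
    ((visited E m ω).card : ℝ≥0∞) ≤ levelTime E l ω +
      ∑' t, {ω | (∃ v, (v, l) ∈ E t ω) ∧ (Y (t + 1) ω).2 ≤ m}.indicator (1 : Ω → ℝ≥0∞) ω := by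
  classical
  rw [← h.tsum_lt_levelTime, ← ENNReal.tsum_add]
  calc ((visited E m ω).card : ℝ≥0∞)
      = ∑ p ∈ visited E m ω, 1 := by simp
    _ ≤ ∑ p ∈ visited E m ω, ∑' t, if Y (t + 1) ω = p then 1 else 0 := by
        refine Finset.sum_le_sum fun p hp => ?_
        obtain ⟨⟨hp1, -⟩, t, ht⟩ := mem_visited.1 hp
        obtain ⟨s, hs⟩ := h.exists_eq_of_mem ht hp1
        exact le_trans (by simp [hs]) (ENNReal.le_tsum s)
    _ = ∑' t, ∑ p ∈ visited E m ω, if Y (t + 1) ω = p then 1 else 0 :=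
        (Summable.tsum_finsetSum fun _ _ => ENNReal.summable).symm
    _ ≤ _ := by
        refine ENNReal.tsum_le_tsum fun t => ?_
        rw [Finset.sum_ite_eq]
        split_ifs with hmem
        · have hle := (mem_visited.1 hmem).1.2
          by_cases hv : ∃ v, (v, l) ∈ E t ω
          · refine le_add_left (le_of_eq ?_)
            exact (Set.indicator_of_mem
              (s := {ω | (∃ v, (v, l) ∈ E t ω) ∧ (Y (t + 1) ω).2 ≤ m}) ⟨hv, hle⟩ (1 : Ω → ℝ≥0∞)).symm
          · refine le_add_right (le_of_eq ?_)
            exact (Set.indicator_of_mem (s := {ω | ¬ ∃ v, (v, l) ∈ E t ω}) hv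
              (1 : Ω → ℝ≥0∞)).symm
        · exact zero_le

end IsClusterGrowth

end Growth

section Law

open scoped ENNReal

/-- A finite partition of a null-measurable set whose outer measures add up correctly consists of
null-measurable sets. -/
lemma nullMeasurableSet_of_sum_measure_le {Ω ι : Type*} [MeasurableSpace Ω] {P : Measure Ω}
    [IsFiniteMeasure P] {F : Finset ι} {s : ι → Set Ω} {S : Set Ω} (hS : NullMeasurableSet S P)
    (hSs : S ⊆ ⋃ i ∈ F, s i) (hsum : ∑ i ∈ F, P (s i) ≤ P S)
    {i : ι} (hi : i ∈ F) : NullMeasurableSet (s i) P := by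
  classical
  set C : Set Ω := ⋃ j ∈ F.erase i, toMeasurable P (s j) with hC
  have hCm : MeasurableSet C :=
    Finset.measurableSet_biUnion _ fun j _ => measurableSet_toMeasurable P (s j)
  have hsub : S \ C ⊆ s i := by
    rintro ω ⟨hω, hωC⟩
    obtain ⟨j, hj, hωj⟩ := Set.mem_iUnion₂.1 (hSs hω)
    by_cases hji : j = i
    · exact hji ▸ hωj
    · exact absurd (Set.mem_iUnion₂.2
        ⟨j, Finset.mem_erase.2 ⟨hji, hj⟩, subset_toMeasurable P (s j) hωj⟩) hωC
  have hPC : P C ≤ ∑ j ∈ F.erase i, P (s j) := by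
    refine (measure_biUnion_finset_le _ _).trans (le_of_eq ?_)
    simp [measure_toMeasurable]
  have hle : P (s i) ≤ P (S \ C) := by
    refine le_trans ?_ le_measure_sdiff
    refine ENNReal.le_sub_of_add_le_right (measure_ne_top P C) ?_
    refine le_trans (by gcongr) ((Finset.add_sum_erase F (fun j => P (s j)) hi).trans_le hsum)
  exact (hS.diff hCm.nullMeasurableSet).congr
    (ae_eq_of_subset_of_measure_ge hsub hle (hS.diff hCm.nullMeasurableSet) (measure_ne_top _ _))

variable {V : Type*} [DecidableEq V] [Fintype V] {G : SimpleGraph V} [DecidableRel G.Adj]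
  {Ω : Type*} [MeasurableSpace Ω] {P : Measure Ω} [IsProbabilityMeasure P]
  {E : ℕ → Ω → Finset (V × ℕ)} {Y : ℕ → Ω → V × ℕ} {w : Finset (V × ℕ) → V × ℕ → ℝ≥0∞}

namespace IsClusterGrowth

variable (h : IsClusterGrowth G E Y)
  (hw : ∀ A, ∑ y ∈ bdryF (cylNbr G) A, w A y ≤ 1)
  (hlaw : ∀ t A, ∀ y ∈ bdryF (cylNbr G) A,
    P {ω | E t ω = A ∧ Y (t + 1) ω = y} = w A y * P {ω | E t ω = A})
include h hw hlaw

lemma nullMeasurableSet_step_of_cluster {t : ℕ} {A : Finset (V × ℕ)}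
    (hA : NullMeasurableSet {ω | E t ω = A} P) (y : V × ℕ) :
    NullMeasurableSet {ω | E t ω = A ∧ Y (t + 1) ω = y} P := by
  by_cases hy : y ∈ bdryF (cylNbr G) A
  · refine nullMeasurableSet_of_sum_measure_le (s := fun y => {ω | E t ω = A ∧ Y (t + 1) ω = y})
      hA ?_ ?_ hy
    · rintro ω (rfl : E t ω = A)
      exact Set.mem_iUnion₂.2 ⟨_, h.mem_bdryF t ω, rfl, rfl⟩
    · rw [Finset.sum_congr rfl fun y hy => hlaw t A y hy, ← Finset.sum_mul]
      exact mul_le_of_le_one_left zero_le (hw A)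
  · convert nullMeasurableSet_empty
    refine Set.eq_empty_of_forall_notMem ?_
    rintro ω ⟨rfl, rfl⟩
    exact hy (h.mem_bdryF t ω)

lemma nullMeasurableSet_cluster (t : ℕ) (A : Finset (V × ℕ)) :
    NullMeasurableSet {ω | E t ω = A} P := by
  induction t generalizing A with
  | zero =>
    simp only [h.zero]
    exact (MeasurableSet.const _).nullMeasurableSet
  | succ t ih =>
    have hU : {ω | E (t + 1) ω = A} =
        ⋃ B, ⋃ y, ⋃ _ : insert y B = A, {ω | E t ω = B ∧ Y (t + 1) ω = y} := by
      ext ω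
      simp only [Set.mem_iUnion]
      constructor
      · intro hω
        exact ⟨E t ω, Y (t + 1) ω, (h.step t ω).symm.trans hω, rfl, rfl⟩
      · rintro ⟨_, _, rfl, rfl, rfl⟩
        exact h.step t ω
    rw [hU]
    exact .iUnion fun B => .iUnion fun y => .iUnion fun _ =>
      h.nullMeasurableSet_step_of_cluster hw hlaw (ih B) y

lemma nullMeasurableSet_step (t : ℕ) (p : Finset (V × ℕ) → V × ℕ → Prop) :
    NullMeasurableSet {ω | p (E t ω) (Y (t + 1) ω)} P := by
  have hU : {ω | p (E t ω) (Y (t + 1) ω)} =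
      ⋃ A, ⋃ y, ⋃ _ : p A y, {ω | E t ω = A ∧ Y (t + 1) ω = y} := by
    ext ω
    simp only [Set.mem_iUnion]
    constructor
    · intro hω
      exact ⟨E t ω, Y (t + 1) ω, hω, rfl, rfl⟩
    · rintro ⟨_, _, hp, rfl, rfl⟩
      exact hp
  rw [hU]
  exact .iUnion fun A => .iUnion fun y => .iUnion fun _ =>
    h.nullMeasurableSet_step_of_cluster hw hlaw (h.nullMeasurableSet_cluster hw hlaw t A) y

lemma aemeasurable_levelTime [Nonempty V] (m : ℕ) :
    AEMeasurable (fun ω => (levelTime E m ω : ℝ≥0∞)) P := by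
  simp only [← h.tsum_lt_levelTime]
  exact AEMeasurable.tsum fun t => aemeasurable_one.indicator₀
    (h.nullMeasurableSet_step hw hlaw t fun A _ => ¬ ∃ v, (v, m) ∈ A)

lemma aemeasurable_card_visited (m : ℕ) :
    AEMeasurable (fun ω => ((visited E m ω).card : ℝ≥0∞)) P := by
  have : (fun ω => ((visited E m ω).card : ℝ≥0∞)) =
      fun ω => ∑ p ∈ Finset.univ ×ˢ Finset.Icc 1 m,
        (⋃ t, {ω | p ∈ E t ω}).indicator (1 : Ω → ℝ≥0∞) ω := by
    classical
    funext ω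
    simp [visited, Set.indicator_apply, Finset.sum_boole]
  rw [this]
  exact Finset.aemeasurable_fun_sum _ fun p _ => aemeasurable_one.indicator₀
    (.iUnion fun t => h.nullMeasurableSet_step hw hlaw t fun A _ => p ∈ A)

/-- The probability of an event about the next step is at most its largest conditional
probability given the current cluster. -/
lemma measure_step_le (t : ℕ) (p : Finset (V × ℕ) → V × ℕ → Prop)
    [∀ A y, Decidable (p A y)] {c : ℝ≥0∞}
    (hc : ∀ ω, ∑ y ∈ bdryF (cylNbr G) (E t ω) with p (E t ω) y, w (E t ω) y ≤ c) :
    P {ω | p (E t ω) (Y (t + 1) ω)} ≤ c := by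
  have hU : {ω | p (E t ω) (Y (t + 1) ω)} ⊆
      ⋃ A, ⋃ y ∈ (bdryF (cylNbr G) A).filter (p A), {ω | E t ω = A ∧ Y (t + 1) ω = y} := by
    intro ω hω
    exact Set.mem_iUnion.2 ⟨E t ω, Set.mem_iUnion₂.2
      ⟨Y (t + 1) ω, Finset.mem_filter.2 ⟨h.mem_bdryF t ω, hω⟩, rfl, rfl⟩⟩
  calc P {ω | p (E t ω) (Y (t + 1) ω)}
      ≤ ∑' A, P (⋃ y ∈ (bdryF (cylNbr G) A).filter (p A),
          {ω | E t ω = A ∧ Y (t + 1) ω = y}) := (measure_mono hU).trans (measure_iUnion_le _)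
    _ ≤ ∑' A, c * P {ω | E t ω = A} := by
        refine ENNReal.tsum_le_tsum fun A => ?_
        rcases Set.eq_empty_or_nonempty {ω | E t ω = A} with hemp | ⟨ω, rfl⟩
        · refine le_of_eq_of_le (measure_mono_null ?_ (measure_empty (μ := P))) zero_le
          rw [← hemp]
          exact Set.iUnion₂_subset fun _ _ ω hω => hω.1
        · refine (measure_biUnion_finset_le _ _).trans ?_
          rw [Finset.sum_congr rfl fun y hy => hlaw t _ y (Finset.mem_filter.1 hy).1,
            ← Finset.sum_mul]
          gcongr
          exact hc ω
    _ = c * ∑' A, P {ω | E t ω = A} := ENNReal.tsum_mul_left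
    _ ≤ c * P Set.univ := by
        gcongr
        refine tsum_measure_le_measure_univ
          (fun A => h.nullMeasurableSet_cluster hw hlaw t A) fun A B hAB => ?_
        refine (Set.disjoint_left.2 ?_).aedisjoint
        rintro ω rfl hB
        exact hAB hB
    _ = c := by simp

end IsClusterGrowth

end Law

section HarmonicMeasure

open scoped ENNReal

lemma sum_ofReal_harmonicMeasure_le {W : Type*} [Infinite W] {nbr : W → Finset W}
    {μh : Finset W → W → ℝ}
    (hμ : ∀ A : Finset W, A.Nonempty → ∀ y ∈ A,
      Tendsto (fun x => hitMeas nbr (↑A) x y) cofinite (𝓝 (μh A y)))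
    {B F : Finset W} (hF : F ⊆ B) {c : ℝ}
    (hc : ∀ᶠ x in cofinite, ∀ N, ∑ y ∈ F, hitP nbr B N x y ≤ c) :
    ∑ y ∈ F, ENNReal.ofReal (μh B y) ≤ ENNReal.ofReal c := by
  have hlim := fun y (hy : y ∈ F) => hμ B ⟨y, hF hy⟩ y (hF hy)
  rw [← ENNReal.ofReal_sum_of_nonneg fun y hy =>
    ge_of_tendsto' (hlim y hy) fun x => hitMeas_nonneg nbr B x y]
  exact ENNReal.ofReal_le_ofReal (le_of_tendsto (tendsto_finsetSum F hlim)
    (hc.mono fun x hx => sum_hitMeas_le nbr B hx))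

lemma integral_natCast_eq {Ω : Type*} [MeasurableSpace Ω] {P : Measure Ω} {f : Ω → ℕ}
    (hf : AEMeasurable (fun ω => (f ω : ℝ≥0∞)) P) :
    ∫ ω, (f ω : ℝ) ∂P = (∫⁻ ω, (f ω : ℝ≥0∞) ∂P).toReal := by
  simpa using integral_toReal hf (ae_of_all _ fun ω => ENNReal.natCast_lt_top (f ω))

lemma tsum_comp_div (f : ℕ → ℝ≥0∞) (n : ℕ) [NeZero n] :
    ∑' t, f (t / n) = n * ∑' j, f j := by
  rw [← (Nat.divModEquiv n).symm.tsum_eq, ← ENNReal.tsum_mul_left,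
    ENNReal.tsum_prod (f := fun a b => f ((Nat.divModEquiv n).symm (a, b) / n))]
  refine tsum_congr fun j => ?_
  have : ∀ r : Fin n, f ((Nat.divModEquiv n).symm (j, r) / n) = f j := fun r => by
    congr 1
    exact congrArg Prod.fst ((Nat.divModEquiv n).apply_symm_apply (j, r))
  rw [tsum_fintype, Finset.sum_congr rfl fun r _ => this r]
  simp

lemma tsum_pow_max_le (Q : ℝ≥0∞) (hQ : Q ≤ 1) (m K : ℕ) :
    ∑' j, Q ^ max K (j - m) ≤ (m + K : ℕ) * Q ^ K + (1 - Q)⁻¹ := by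
  rw [← Summable.sum_add_tsum_nat_add' (k := m + K) ENNReal.summable, ← ENNReal.tsum_geometric]
  refine add_le_add ?_ (ENNReal.tsum_le_tsum fun j => pow_le_pow_right_of_le_one' hQ (by omega))
  refine (Finset.sum_le_card_nsmul _ _ (Q ^ K) fun j _ =>
    pow_le_pow_right_of_le_one' hQ (le_max_left _ _)).trans (by simp)

variable {V : Type*} [DecidableEq V] [Fintype V] {G : SimpleGraph V} [DecidableRel G.Adj]
  {μh : Finset (V × ℕ) → V × ℕ → ℝ}

lemma sum_ofReal_bdryF_le_one [Nonempty V] (G : SimpleGraph V) [DecidableRel G.Adj]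
    (hμ : ∀ A : Finset (V × ℕ), A.Nonempty → ∀ y ∈ A,
      Tendsto (fun x => hitMeas (cylNbr G) (↑A) x y) cofinite (𝓝 (μh A y)))
    (A : Finset (V × ℕ)) :
    ∑ y ∈ bdryF (cylNbr G) A, ENNReal.ofReal (μh (bdryF (cylNbr G) A) y) ≤ 1 := by
  simpa using sum_ofReal_harmonicMeasure_le hμ (Finset.Subset.refl (bdryF (cylNbr G) A))
    (Eventually.of_forall fun x N => sum_hitP_le_one _ _ _ N x)

namespace IsClusterGrowth

variable [Nonempty V] {Ω : Type*} [MeasurableSpace Ω] {P : Measure Ω} [IsProbabilityMeasure P]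
  {E : ℕ → Ω → Finset (V × ℕ)} {Y : ℕ → Ω → V × ℕ} {w : Finset (V × ℕ) → V × ℕ → ℝ≥0∞}
  (h : IsClusterGrowth G E Y)
  (hw : ∀ A, ∑ y ∈ bdryF (cylNbr G) A, w A y ≤ 1)
  (hlaw : ∀ t A, ∀ y ∈ bdryF (cylNbr G) A,
    P {ω | E t ω = A ∧ Y (t + 1) ω = y} = w A y * P {ω | E t ω = A})
  (hG : G.Connected)
  (hμ : ∀ A : Finset (V × ℕ), A.Nonempty → ∀ y ∈ A,
    Tendsto (fun x => hitMeas (cylNbr G) (↑A) x y) cofinite (𝓝 (μh A y)))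
  (hwμ : ∀ A, ∀ y ∈ bdryF (cylNbr G) A, w A y = ENNReal.ofReal (μh (bdryF (cylNbr G) A) y))
include h hw hlaw hG hμ hwμ

/-- Once the cluster has reached level `l`, the next particle lands at a level at most `m` with
probability exponentially small in `l - m`. -/
lemma measure_snd_le (t l m : ℕ) :
    P {ω | (∃ v, (v, l) ∈ E t ω) ∧ (Y (t + 1) ω).2 ≤ m} ≤
      ENNReal.ofReal (1 - (((Fintype.card V : ℝ) + 2)⁻¹) ^ Fintype.card V) ^ (l - m) := by
  classical
  rcases le_total l m with hlm | hlm
  · simpa [Nat.sub_eq_zero_of_le hlm] using prob_le_one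
  obtain ⟨K, rfl⟩ := Nat.exists_eq_add_of_le hlm
  rw [Nat.add_sub_cancel_left, ← ENNReal.ofReal_pow (sub_nonneg.2 (pow_le_one₀ (by positivity)
    (inv_le_one_of_one_le₀ (by linarith [(Fintype.card V).cast_nonneg (α := ℝ)]))))]
  refine h.measure_step_le hw hlaw t (fun A y => (∃ v, (v, m + K) ∈ A) ∧ y.2 ≤ m) fun ω => ?_
  by_cases hv : ∃ v, (v, m + K) ∈ E t ω
  · obtain ⟨v, hv'⟩ := hv
    rw [Finset.sum_congr rfl fun y hy => hwμ _ y (Finset.mem_filter.1 hy).1]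
    refine sum_ofReal_harmonicMeasure_le hμ (Finset.filter_subset _ _) ?_
    have hfin : ((E t ω : Set (V × ℕ)) ∪ Set.univ ×ˢ Set.Iio (m + K)).Finite :=
      (E t ω).finite_toSet.union (Set.finite_univ.prod (Set.finite_Iio _))
    filter_upwards [hfin.compl_mem_cofinite] with x hx N
    simp only [Set.compl_union, Set.mem_inter_iff, Set.mem_compl_iff, Finset.mem_coe,
      Set.mem_prod, Set.mem_univ, true_and, Set.mem_Iio, not_lt] at hx
    exact sum_hitP_bdryF_le G hG (fun y hy => (Finset.mem_filter.1 hy).2.2)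
      (fun j hj => h.exists_mem_of_le hv' hj) le_rfl N hx.1 hx.2
  · simp [hv]

lemma lintegral_card_visited_le {m K : ℕ} (hK : K ≤ m) :
    ∫⁻ ω, ((visited E m ω).card : ℝ≥0∞) ∂P ≤ ∫⁻ ω, (levelTime E m ω : ℝ≥0∞) ∂P +
      Fintype.card V * (K + (m *
        ENNReal.ofReal (1 - (((Fintype.card V : ℝ) + 2)⁻¹) ^ Fintype.card V) ^ K +
        (1 - ENNReal.ofReal (1 - (((Fintype.card V : ℝ) + 2)⁻¹) ^ Fintype.card V))⁻¹)) := by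
  set Q := ENNReal.ofReal (1 - (((Fintype.card V : ℝ) + 2)⁻¹) ^ Fintype.card V) with hQdef
  have hQ : Q ≤ 1 := by
    rw [hQdef, ENNReal.ofReal_le_one]
    have : (0 : ℝ) ≤ (((Fintype.card V : ℝ) + 2)⁻¹) ^ Fintype.card V := by positivity
    linarith
  obtain ⟨m, rfl⟩ := Nat.exists_eq_add_of_le' hK
  set late : ℕ → Set Ω := fun t => {ω | (∃ v, (v, m + K) ∈ E t ω) ∧ (Y (t + 1) ω).2 ≤ m}
    with hlate
  have hnull : ∀ t, NullMeasurableSet (late t) P := fun t =>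
    h.nullMeasurableSet_step hw hlaw t fun A y => (∃ v, (v, m + K) ∈ A) ∧ y.2 ≤ m
  have hprob : ∀ t, P (late t) ≤ Q ^ max K (t / Fintype.card V - m) := by
    intro t
    rcases max_choice K (t / Fintype.card V - m) with hmax | hmax
    · rw [hmax]
      have := h.measure_snd_le hw hlaw hG hμ hwμ t (m + K) m
      rwa [Nat.add_sub_cancel_left] at this
    · rw [hmax]
      refine (measure_mono fun ω hω => ?_).trans
        (h.measure_snd_le hw hlaw hG hμ hwμ t (t / Fintype.card V) m)
      exact ⟨h.exists_mem_level (Nat.mul_div_le t _) ω, hω.2⟩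
  have hsum : ∑' t, P (late t) ≤ Fintype.card V * ((m + K : ℕ) * Q ^ K + (1 - Q)⁻¹) := by
    refine (ENNReal.tsum_le_tsum hprob).trans ?_
    rw [tsum_comp_div (fun j => Q ^ max K (j - m))]
    gcongr
    exact tsum_pow_max_le Q hQ m K
  calc ∫⁻ ω, ((visited E (m + K) ω).card : ℝ≥0∞) ∂P
      ≤ ∫⁻ ω, (levelTime E (m + K) ω + ∑' t, (late t).indicator (1 : Ω → ℝ≥0∞) ω
          + Fintype.card V * K) ∂P := by
        refine lintegral_mono fun ω => ?_
        refine le_trans ?_ (add_le_add_left (h.card_visited_le_levelTime_add m (m + K) ω) _)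
        exact_mod_cast card_visited_add_le E m K ω
    _ = ∫⁻ ω, (levelTime E (m + K) ω : ℝ≥0∞) ∂P + ∑' t, P (late t) + Fintype.card V * K := by
        rw [lintegral_add_right _ measurable_const,
          lintegral_add_left' (h.aemeasurable_levelTime hw hlaw (m + K)),
          lintegral_tsum (f := fun t => (late t).indicator (1 : Ω → ℝ≥0∞))
            fun t => aemeasurable_one.indicator₀ (hnull t)]
        simp only [lintegral_indicator_one₀ (hnull _), lintegral_const, measure_univ, mul_one]
    _ ≤ _ := by
        rw [mul_add, add_assoc, add_comm (∑' t, P (late t))]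
        gcongr

end IsClusterGrowth

end HarmonicMeasure

/-- **External DLA on cylinders: the density at infinity equals the average growth rate
(Benjamini–Yadin).**  For external DLA on `G × ℕ` with `G` a `d`-regular graph on `n`
vertices, the density at infinity `D` satisfies `D = lim_{m→∞} E[T_m]/(mn)`. -/
theorem external_dla_cylinder_density_eq_growth_rate
    (d n : ℕ)
    (V : Type) [Fintype V] [DecidableEq V] (G : SimpleGraph V) [DecidableRel G.Adj]
    (hconn : G.Connected) (hcard : Fintype.card V = n) (hreg : ∀ v : V, G.degree v = d)
    {Ω : Type*} [MeasurableSpace Ω] (P : Measure Ω) [IsProbabilityMeasure P]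
    (E : ℕ → Ω → Finset (V × ℕ)) (Y : ℕ → Ω → V × ℕ)
    -- the harmonic measure from infinity on the (recurrent) cylinder `G × ℕ`
    (μh : Finset (V × ℕ) → V × ℕ → ℝ)
    (hμ : ∀ A : Finset (V × ℕ), A.Nonempty → ∀ y ∈ A,
      Tendsto (fun x => hitMeas (cylNbr G) (↑A) x y) cofinite (𝓝 (μh A y)))
    -- dynamics of the external DLA chain, started from the zeroth level `G₀`
    (h0 : ∀ ω, E 0 ω = Finset.univ.image (fun v : V => (v, 0)))
    (hstep : ∀ n' ω, E (n'+1) ω = insert (Y (n'+1) ω) (E n' ω))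
    (hbd : ∀ n' ω, Y (n'+1) ω ∈ bdryF (cylNbr G) (E n' ω))
    (hlaw : ∀ (n' : ℕ) (A : Finset (V × ℕ)), ∀ y ∈ bdryF (cylNbr G) A,
      P {ω | E n' ω = A ∧ Y (n'+1) ω = y}
        = ENNReal.ofReal (μh (bdryF (cylNbr G) A) y) * P {ω | E n' ω = A})
    -- `D` is the density at infinity: the a.s. limit of the empirical densities `D(m)`
    (D : ℝ)
    (hD : ∀ᵐ ω ∂P,
      Tendsto
        (fun m : ℕ =>
          (∑ i ∈ Finset.Icc 1 m,
            (({p ∈ ⋃ t, (E t ω : Set (V × ℕ)) | p.2 = i}).ncard : ℝ)) / (m * n))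
        atTop (𝓝 D)) :
    -- conclusion: `D = lim_{m→∞} E[T_m]/(mn)`
    Tendsto (fun m : ℕ => (∫ ω, (levelTime E m ω : ℝ) ∂P) / (m * n)) atTop (𝓝 D) := by
  classical
  subst hcard
  have hne : Nonempty V := hconn.nonempty
  have h : IsClusterGrowth G E Y := ⟨h0, hstep, hbd⟩
  set δ : ℝ := (((Fintype.card V : ℝ) + 2)⁻¹) ^ Fintype.card V with hδ
  have hδ0 : 0 < δ := by positivity
  have hδ1 : δ ≤ 1 := pow_le_one₀ (by positivity)
    (inv_le_one_of_one_le₀ (by linarith [(Fintype.card V).cast_nonneg (α := ℝ)]))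
  have hn : (0 : ℝ) < Fintype.card V := by exact_mod_cast Fintype.card_pos
  have hw := sum_ofReal_bdryF_le_one G hμ
  have hT := fun m => integral_natCast_eq (h.aemeasurable_levelTime hw hlaw m)
  have hN := fun m => integral_natCast_eq (h.aemeasurable_card_visited hw hlaw m)
  have hNtop : ∀ m, ∫⁻ ω, ((visited E m ω).card : ENNReal) ∂P ≠ ⊤ := fun m =>
    ne_top_of_le_ne_top (b := ((Fintype.card V * m : ℕ) : ENNReal)) (ENNReal.natCast_ne_top _)
      ((lintegral_mono fun ω => Nat.cast_le.2 (card_visited_le E m ω)).trans (by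
        rw [lintegral_const, measure_univ, mul_one]))
  have hTN : ∀ m, ∫⁻ ω, (levelTime E m ω : ENNReal) ∂P ≤
      ∫⁻ ω, ((visited E m ω).card : ENNReal) ∂P := fun m =>
    lintegral_mono fun ω => Nat.cast_le.2 (h.levelTime_le_card_visited m ω)
  have hQ : 1 - ENNReal.ofReal (1 - δ) ≠ 0 :=
    (tsub_pos_of_lt (by rw [ENNReal.ofReal_lt_one]; linarith)).ne'
  set C : ℝ := ((1 - ENNReal.ofReal (1 - δ))⁻¹).toReal with hC
  have hNT : ∀ m K, K ≤ m → ∫ ω, ((visited E m ω).card : ℝ) ∂P ≤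
      ∫ ω, (levelTime E m ω : ℝ) ∂P + Fintype.card V * (K + (m * (1 - δ) ^ K + C)) := by
    intro m K hK
    rw [hT, hN]
    have hle := ENNReal.toReal_mono ?_
      (h.lintegral_card_visited_le hw hlaw hconn hμ (fun _ _ _ => rfl) hK)
    · rw [ENNReal.toReal_add (ne_top_of_le_ne_top (hNtop m) (hTN m)) (by finiteness),
        ENNReal.toReal_mul, ENNReal.toReal_add (by finiteness) (by finiteness),
        ENNReal.toReal_add (by finiteness) (by finiteness), ENNReal.toReal_mul,
        ENNReal.toReal_pow, ENNReal.toReal_ofReal (by linarith)] at hle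
      simpa only [ENNReal.toReal_natCast] using hle
    · have := ne_top_of_le_ne_top (hNtop m) (hTN m)
      finiteness
  have hlim : Tendsto
      (fun m : ℕ => (∫ ω, ((visited E m ω).card : ℝ) ∂P) / (m * Fintype.card V)) atTop (𝓝 D) := by
    simp only [← integral_div]
    have hDint : ∫ _ : Ω, D ∂P = D := by simp
    rw [← hDint]
    refine tendsto_integral_of_dominated_convergence (fun _ => 1) (fun m => ?_)
      (integrable_const _) (fun m => ae_of_all _ fun ω => ?_) ?_
    · have := (h.aemeasurable_card_visited hw hlaw m).ennreal_toReal
      simp only [ENNReal.toReal_natCast] at this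
      exact (this.div_const _).aestronglyMeasurable
    · rw [Real.norm_of_nonneg (by positivity)]
      refine div_le_one_of_le₀ ?_ (by positivity)
      rw [mul_comm]
      exact_mod_cast card_visited_le E m ω
    · filter_upwards [hD] with ω hω
      refine hω.congr fun m => ?_
      rw [← sum_ncard_eq_card_visited]
      push_cast
      rfl
  have hsqrt : Tendsto Nat.sqrt atTop atTop :=
    tendsto_atTop.2 fun b => (eventually_ge_atTop (b * b)).mono fun m hm => Nat.le_sqrt.2 hm
  have herr : Tendsto (fun m : ℕ => ((Nat.sqrt m : ℝ))⁻¹ + (1 - δ) ^ Nat.sqrt m + C / m)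
      atTop (𝓝 0) := by
    have h1 : Tendsto (fun m : ℕ => ((Nat.sqrt m : ℝ))⁻¹) atTop (𝓝 0) :=
      tendsto_inv_atTop_zero.comp (tendsto_natCast_atTop_atTop.comp hsqrt)
    have h2 : Tendsto (fun m : ℕ => (1 - δ) ^ Nat.sqrt m) atTop (𝓝 0) :=
      (tendsto_pow_atTop_nhds_zero_of_lt_one (by linarith) (by linarith)).comp hsqrt
    simpa using (h1.add h2).add (tendsto_const_div_atTop_nhds_zero_nat C)
  refine tendsto_of_tendsto_of_tendsto_of_le_of_le' (by simpa using hlim.sub herr) hlim ?_ ?_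
  · filter_upwards [eventually_ge_atTop 1] with m hm
    have hm' : (0 : ℝ) < m := by exact_mod_cast hm
    have hs : (0 : ℝ) < Nat.sqrt m := by exact_mod_cast Nat.sqrt_pos.2 hm
    have hss : (Nat.sqrt m : ℝ) * Nat.sqrt m ≤ m := by exact_mod_cast Nat.sqrt_le m
    have hle := hNT m (Nat.sqrt m) (Nat.sqrt_le_self m)
    have hK : (Nat.sqrt m : ℝ) / m ≤ (Nat.sqrt m : ℝ)⁻¹ := by
      rw [div_le_iff₀ hm', inv_mul_eq_div, le_div_iff₀ hs]
      exact hss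
    rw [sub_le_iff_le_add]
    calc (∫ ω, ((visited E m ω).card : ℝ) ∂P) / (m * Fintype.card V)
        ≤ (∫ ω, (levelTime E m ω : ℝ) ∂P +
            Fintype.card V * (Nat.sqrt m + (m * (1 - δ) ^ Nat.sqrt m + C))) /
              (m * Fintype.card V) := by gcongr
      _ = (∫ ω, (levelTime E m ω : ℝ) ∂P) / (m * Fintype.card V) +
            (Nat.sqrt m / m + (1 - δ) ^ Nat.sqrt m + C / m) := by field_simp; ring
      _ ≤ _ := by gcongr
  · filter_upwards with m
    rw [hT, hN]
    exact div_le_div_of_nonneg_right (ENNReal.toReal_mono (hNtop m) (hTN m)) (by positivity)
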